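/- For every capacity-bounded phrase structure grammar (in the sense of Ginsburg and Spanier, with left-hand sides in V⁺) G = (V, Σ, S, R, κ), there exists a capacity-bounded phrase structure grammar G' with capacity function constantly 1 such that L(G') = L(G). -/

import Mathlib

/-! Common definitions: symbols, context-free grammars, Ginsburg–Spanier phrase
structure grammars, capacity-bounded derivations, matrix/vector grammars,
finite index, cf Petri nets with place capacities, and language families. -/

inductive Symb (N T : Type) where
  | nt : N → Symb N T
  | tm : T → Symb N T
deriving DecidableEq

namespace CapGram

variable {N T Δ α : Type}

open Classical in
/-- Number of occurrences of the nonterminal `A` in a sentential form. -/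
noncomputable def symCount (A : N) : List (Symb N T) → ℕ
  | [] => 0
  | Symb.nt B :: r => (if B = A then 1 else 0) + symCount A r
  | Symb.tm _ :: r => symCount A r

/-- Total number of nonterminal occurrences in a sentential form. -/
def ntCount : List (Symb N T) → ℕ
  | [] => 0
  | Symb.nt _ :: r => 1 + ntCount r
  | Symb.tm _ :: r => ntCount r

/-- The sentential form `w` respects the capacity function `κ`. -/
def CapOK (κ : N → ℕ) (w : List (Symb N T)) : Prop :=
  ∀ A : N, symCount A w ≤ κ A

/-- A context-free grammar (rules are pairs of a nonterminal and a word). -/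
structure CFG (N T : Type) where
  start : N
  rules : Finset (N × List (Symb N T))

/-- Application of a single context-free rule. -/
def applyRule (r : N × List (Symb N T)) (u v : List (Symb N T)) : Prop :=
  ∃ x y : List (Symb N T), u = x ++ Symb.nt r.1 :: y ∧ v = x ++ r.2 ++ y

def CFG.Step (G : CFG N T) (u v : List (Symb N T)) : Prop :=
  ∃ r ∈ G.rules, applyRule r u v

/-- A derivation step both of whose sentential forms respect the capacity. -/
def CFG.CapStep (G : CFG N T) (κ : N → ℕ) (u v : List (Symb N T)) : Prop :=
  G.Step u v ∧ CapOK κ u ∧ CapOK κ v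

/-- A derivation step both of whose sentential forms have at most `k`
nonterminal occurrences in total. -/
def CFG.IdxStep (G : CFG N T) (k : ℕ) (u v : List (Symb N T)) : Prop :=
  G.Step u v ∧ ntCount u ≤ k ∧ ntCount v ≤ k

/-- The (unrestricted) language of a context-free grammar. -/
def CFG.Lang (G : CFG N T) : Set (List T) :=
  { w | Relation.ReflTransGen G.Step [Symb.nt G.start] (w.map Symb.tm) }

/-- The language of the capacity-bounded grammar `(G, κ)`. -/
def CFG.CapLang (G : CFG N T) (κ : N → ℕ) : Set (List T) :=
  { w | Relation.ReflTransGen (G.CapStep κ) [Symb.nt G.start] (w.map Symb.tm) }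

/-- Words with a derivation of index at most `k`. -/
def CFG.FinLang (G : CFG N T) (k : ℕ) : Set (List T) :=
  { w | Relation.ReflTransGen (G.IdxStep k) [Symb.nt G.start] (w.map Symb.tm) }

/-- A phrase structure grammar due to Ginsburg and Spanier: the left-hand side
of a rule is a nonempty word of nonterminals, encoded as head and tail. -/
structure GSG (N T : Type) where
  start : N
  rules : Finset ((N × List N) × List (Symb N T))

def GSG.Step (G : GSG N T) (u v : List (Symb N T)) : Prop :=
  ∃ r ∈ G.rules, ∃ x y : List (Symb N T),
    u = x ++ (r.1.1 :: r.1.2).map Symb.nt ++ y ∧ v = x ++ r.2 ++ y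

def GSG.CapStep (G : GSG N T) (κ : N → ℕ) (u v : List (Symb N T)) : Prop :=
  G.Step u v ∧ CapOK κ u ∧ CapOK κ v

def GSG.Lang (G : GSG N T) : Set (List T) :=
  { w | Relation.ReflTransGen G.Step [Symb.nt G.start] (w.map Symb.tm) }

def GSG.CapLang (G : GSG N T) (κ : N → ℕ) : Set (List T) :=
  { w | Relation.ReflTransGen (G.CapStep κ) [Symb.nt G.start] (w.map Symb.tm) }

/-- Derivations labeled by their sequence of context-free rules, where every
sentential form (including the first and last) satisfies the invariant `P`. -/
inductive DerivP (P : List (Symb N T) → Prop) :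
    List (N × List (Symb N T)) → List (Symb N T) → List (Symb N T) → Prop
  | nil (u : List (Symb N T)) : P u → DerivP P [] u u
  | cons {r π u v w} : P u → applyRule r u v → DerivP P π v w →
      DerivP P (r :: π) u w

/-- A matrix grammar: a finite set of matrices (sequences of cf rules). -/
structure MG (N T : Type) where
  start : N
  mats : Finset (List (N × List (Symb N T)))

/-- Matrix language: rule sequences are concatenations of matrices. -/
def MG.Lang (G : MG N T) : Set (List T) :=
  { w | ∃ ms : List (List (N × List (Symb N T))),
      (∀ m ∈ ms, m ∈ G.mats) ∧
      DerivP (fun _ => True) ms.flatten [Symb.nt G.start] (w.map Symb.tm) }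

/-- Words with a matrix derivation of index at most `k`. -/
def MG.FinLang (G : MG N T) (k : ℕ) : Set (List T) :=
  { w | ∃ ms : List (List (N × List (Symb N T))),
      (∀ m ∈ ms, m ∈ G.mats) ∧
      DerivP (fun u => ntCount u ≤ k) ms.flatten [Symb.nt G.start] (w.map Symb.tm) }

/-- `Shuffle ms π`: `π` is an interleaving (shuffle) of the lists in `ms`. -/
inductive Shuffle : List (List α) → List α → Prop
  | nil (ms : List (List α)) : (∀ l ∈ ms, l = []) → Shuffle ms []
  | cons {ms₁ : List (List α)} {l : List α} {ms₂ : List (List α)} {π : List α}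
      (a : α) : Shuffle (ms₁ ++ l :: ms₂) π →
      Shuffle (ms₁ ++ (a :: l) :: ms₂) (a :: π)

/-- A vector grammar: like a matrix grammar, but derivations use shuffles. -/
structure VG (N T : Type) where
  start : N
  mats : Finset (List (N × List (Symb N T)))

def VG.Lang (G : VG N T) : Set (List T) :=
  { w | ∃ ms π, (∀ m ∈ ms, m ∈ G.mats) ∧ Shuffle ms π ∧
      DerivP (fun _ => True) π [Symb.nt G.start] (w.map Symb.tm) }

def VG.CapLang (G : VG N T) (κ : N → ℕ) : Set (List T) :=
  { w | ∃ ms π, (∀ m ∈ ms, m ∈ G.mats) ∧ Shuffle ms π ∧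
      DerivP (CapOK κ) π [Symb.nt G.start] (w.map Symb.tm) }

def VG.FinLang (G : VG N T) (k : ℕ) : Set (List T) :=
  { w | ∃ ms π, (∀ m ∈ ms, m ∈ G.mats) ∧ Shuffle ms π ∧
      DerivP (fun u => ntCount u ≤ k) π [Symb.nt G.start] (w.map Symb.tm) }

/-! cf Petri nets: places are in bijection with the nonterminals, transitions
with the rules; firing the transition of rule `A → α` consumes one token from
the place of `A` and adds `|α|_X` tokens to the place of each nonterminal `X`. -/

open Classical in
/-- Firing of the transition corresponding to rule `r`, turning marking `μ`
into marking `μ'`. -/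
noncomputable def ruleFire (r : N × List (Symb N T)) (μ μ' : N → ℕ) : Prop :=
  1 ≤ μ r.1 ∧ ∀ A, μ' A = μ A - (if A = r.1 then 1 else 0) + symCount A r.2

/-- Occurrence sequences of the cf Petri net of `G`, all of whose markings
(including initial and final) satisfy the validity predicate `P`. -/
inductive FireSeqP (G : CFG N T) (P : (N → ℕ) → Prop) :
    List (N × List (Symb N T)) → (N → ℕ) → (N → ℕ) → Prop
  | nil (μ : N → ℕ) : P μ → FireSeqP G P [] μ μ
  | cons {r π μ μ' μ''} : r ∈ G.rules → P μ → ruleFire r μ μ' →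
      FireSeqP G P π μ' μ'' → FireSeqP G P (r :: π) μ μ''

open Classical in
/-- The initial marking: one token on the place of the start symbol. -/
noncomputable def initMark (G : CFG N T) : N → ℕ :=
  fun A => if A = G.start then 1 else 0

/-- The language of `G` controlled by its cf Petri net restricted to markings
satisfying `P` (e.g. a place capacity constraint). -/
def CFG.PNLang (G : CFG N T) (P : (N → ℕ) → Prop) : Set (List T) :=
  { w | ∃ π μ, DerivP (fun _ => True) π [Symb.nt G.start] (w.map Symb.tm) ∧
      FireSeqP G P π (initMark G) μ }

/-! Language families over a terminal alphabet `T`. -/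

/-- Context-free languages of finite index. -/
def CFfin (T : Type) : Set (Set (List T)) :=
  { L | ∃ (N : Type) (_ : Fintype N) (G : CFG N T) (k : ℕ),
      L = G.Lang ∧ G.Lang ⊆ G.FinLang k }

/-- Languages of capacity-bounded context-free grammars. -/
def CFcb (T : Type) : Set (Set (List T)) :=
  { L | ∃ (N : Type) (_ : Fintype N) (G : CFG N T) (κ : N → ℕ),
      L = G.CapLang κ }

/-- Languages of capacity-bounded Ginsburg–Spanier phrase structure grammars. -/
def GScb (T : Type) : Set (Set (List T)) :=
  { L | ∃ (N : Type) (_ : Fintype N) (G : GSG N T) (κ : N → ℕ),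
      L = G.CapLang κ }

/-- Matrix languages of finite index. -/
def MATfin (T : Type) : Set (Set (List T)) :=
  { L | ∃ (N : Type) (_ : Fintype N) (G : MG N T) (k : ℕ),
      L = G.Lang ∧ G.Lang ⊆ G.FinLang k }

/-- Capacity-bounded vector languages (erasing rules allowed). -/
def Vcb (T : Type) : Set (Set (List T)) :=
  { L | ∃ (N : Type) (_ : Fintype N) (G : VG N T) (κ : N → ℕ),
      L = G.CapLang κ }

/-- Vector languages of finite index (erasing rules allowed). -/
def Vfin (T : Type) : Set (Set (List T)) :=
  { L | ∃ (N : Type) (_ : Fintype N) (G : VG N T) (k : ℕ),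
      L = G.Lang ∧ G.Lang ⊆ G.FinLang k }

/-- Languages of grammars controlled by cf Petri nets with place capacities. -/
def PNcap (T : Type) : Set (Set (List T)) :=
  { L | ∃ (N : Type) (_ : Fintype N) (G : CFG N T) (κ : N → ℕ),
      L = G.PNLang (fun μ => ∀ A, μ A ≤ κ A) }


/-- Relabel the nonterminal of a symbol along `f`, leaving terminals unchanged. -/
def mapNt {M : Type} (f : M → N) : Symb M T → Symb N T
  | Symb.nt B => Symb.nt (f B)
  | Symb.tm t => Symb.tm t

@[simp] theorem mapNt_nt {M : Type} (f : M → N) (B : M) :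
    mapNt f (Symb.nt B : Symb M T) = Symb.nt (f B) := rfl

@[simp] theorem mapNt_tm {M : Type} (f : M → N) (t : T) :
    mapNt f (Symb.tm t : Symb M T) = Symb.tm t := rfl

@[simp] theorem map_mapNt_map_nt {M : Type} (f : M → N) (l : List M) :
    (l.map (Symb.nt (T := T))).map (mapNt f) = (l.map f).map Symb.nt := by
  simp [Function.comp_def]

@[simp] theorem map_mapNt_map_tm {M : Type} (f : M → N) (w : List T) :
    (w.map (Symb.tm (N := M))).map (mapNt f) = w.map Symb.tm := by
  simp [Function.comp_def]

theorem exists_map_nt_of_map_mapNt {M : Type} (f : M → N) (l : List N)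
    (u : List (Symb M T)) (h : u.map (mapNt f) = l.map Symb.nt) :
    ∃ l' : List M, u = l'.map Symb.nt ∧ l'.map f = l := by
  induction u generalizing l with
  | nil => exact ⟨[], rfl, by simpa using h⟩
  | cons s u ih =>
    obtain _ | ⟨A, l⟩ := l
    · simp at h
    · obtain B | t := s
      · simp only [List.map_cons, mapNt_nt, List.cons.injEq, Symb.nt.injEq] at h
        obtain ⟨l', rfl, rfl⟩ := ih l h.2
        exact ⟨B :: l', rfl, by simp [h.1]⟩
      · simp at h

theorem eq_map_tm_of_map_mapNt {M : Type} (f : M → N) (w : List T)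
    (u : List (Symb M T)) (h : u.map (mapNt f) = w.map Symb.tm) :
    u = w.map Symb.tm := by
  induction u generalizing w with
  | nil => cases w <;> simp_all
  | cons s u ih =>
    obtain _ | ⟨t, w⟩ := w
    · simp at h
    · obtain B | t' := s
      · simp at h
      · simp only [List.map_cons, mapNt_tm, List.cons.injEq, Symb.tm.injEq] at h
        rw [ih w h.2, h.1, List.map_cons]

theorem finite_preimage_mapNt {M : Type} [Finite M] (f : M → N) (s : Symb N T) :
    (mapNt f ⁻¹' {s}).Finite := by
  obtain A | t := s
  · refine (Set.finite_range (Symb.nt (N := M) (T := T))).subset ?_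
    rintro (B | t) h
    · exact ⟨B, rfl⟩
    · simp at h
  · refine (Set.finite_singleton (Symb.tm (N := M) t)).subset ?_
    rintro (B | t) h
    · simp at h
    · simpa using h

theorem finite_preimage_map {β : Type} (f : α → β) (hf : ∀ b, (f ⁻¹' {b}).Finite)
    (l : List β) : (List.map f ⁻¹' {l}).Finite := by
  induction l with
  | nil =>
    refine (Set.finite_singleton ([] : List α)).subset ?_
    intro u h
    simpa using h
  | cons b l ih =>
    refine ((hf b).image2 List.cons ih).subset ?_
    intro u h
    obtain _ | ⟨a, u⟩ := u
    · simp at h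
    · simp only [Set.mem_preimage, List.map_cons, Set.mem_singleton_iff, List.cons.injEq] at h
      exact ⟨a, h.1, u, h.2, rfl⟩

/-- Relabel all nonterminals of a rule along `f`. -/
def mapRule {M : Type} (f : M → N) (r : (M × List M) × List (Symb M T)) :
    (N × List N) × List (Symb N T) :=
  ((f r.1.1, r.1.2.map f), r.2.map (mapNt f))

theorem finite_preimage_mapRule {M : Type} [Finite M] (f : M → N)
    (R : Finset ((N × List N) × List (Symb N T))) :
    (mapRule f ⁻¹' (R : Set ((N × List N) × List (Symb N T)))).Finite := by
  refine R.finite_toSet.preimage' ?_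
  rintro ⟨⟨A, l⟩, w⟩ -
  refine ((((Set.toFinite (f ⁻¹' {A})).prod
    (finite_preimage_map f (fun _ => Set.toFinite _) l)).prod
    (finite_preimage_map (mapNt f) (finite_preimage_mapNt f) w))).subset ?_
  rintro ⟨⟨A', l'⟩, w'⟩ h
  simpa [mapRule, and_assoc] using h

/-- The grammar whose rules are all those that `f` relabels to a rule of `G`. -/
noncomputable def GSG.comap {M : Type} [Finite M] (G : GSG N T) (f : M → N) (S : M) :
    GSG M T where
  start := S
  rules := (finite_preimage_mapRule f G.rules).toFinset

theorem GSG.mem_rules_comap {M : Type} [Finite M] (G : GSG N T) (f : M → N) (S : M)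
    (r : (M × List M) × List (Symb M T)) :
    r ∈ (G.comap f S).rules ↔ mapRule f r ∈ G.rules := by
  simp [GSG.comap]

theorem GSG.Step.of_comap {M : Type} [Finite M] {G : GSG N T} {f : M → N} {S : M}
    {u v : List (Symb M T)} (h : (G.comap f S).Step u v) :
    G.Step (u.map (mapNt f)) (v.map (mapNt f)) := by
  obtain ⟨r, hr, x, y, rfl, rfl⟩ := h
  refine ⟨mapRule f r, (G.mem_rules_comap f S r).1 hr, x.map (mapNt f), y.map (mapNt f), ?_, ?_⟩
  · simp [mapRule, Function.comp_def]
  · simp [mapRule]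

theorem symCount_append (A : N) (u v : List (Symb N T)) :
    symCount A (u ++ v) = symCount A u + symCount A v := by
  induction u with
  | nil => simp [symCount]
  | cons s u ih => cases s <;> simp [symCount, ih, add_assoc]

theorem symCount_map_mapNt_fst {κ : N → ℕ} (A : N)
    (u : List (Symb (Σ A : N, Fin (κ A)) T)) :
    symCount A (u.map (mapNt Sigma.fst)) = ∑ i : Fin (κ A), symCount ⟨A, i⟩ u := by
  induction u with
  | nil => simp [symCount]
  | cons s u ih =>
    obtain ⟨B, j⟩ | t := s
    · simp only [List.map_cons, mapNt_nt, symCount, ih, Finset.sum_add_distrib]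
      congr 1
      by_cases h : B = A
      · subst h
        simp
      · simp [h]
    · simpa [symCount] using ih

theorem CapOK.map_mapNt_fst {κ : N → ℕ} {u : List (Symb (Σ A : N, Fin (κ A)) T)}
    (h : CapOK (fun _ => 1) u) : CapOK κ (u.map (mapNt Sigma.fst)) := by
  intro A
  rw [symCount_map_mapNt_fst]
  simpa using Finset.sum_le_card_nsmul Finset.univ (fun i => symCount ⟨A, i⟩ u) 1
    (fun i _ => h ⟨A, i⟩)

/-- A word inserted into an injectively indexed context can be indexed injectively as well,
as long as the capacities are respected. -/
theorem exists_capOK_one_lift {κ : N → ℕ} (r : List (Symb N T))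
    (x y : List (Symb (Σ A : N, Fin (κ A)) T)) (hxy : CapOK (fun _ => 1) (x ++ y))
    (h : CapOK κ (x.map (mapNt Sigma.fst) ++ r ++ y.map (mapNt Sigma.fst))) :
    ∃ r' : List (Symb (Σ A : N, Fin (κ A)) T),
      r'.map (mapNt Sigma.fst) = r ∧ CapOK (fun _ => 1) (x ++ r' ++ y) := by
  induction r generalizing x with
  | nil => exact ⟨[], rfl, by simpa using hxy⟩
  | cons s r ih =>
    suffices hs : ∃ s' : Symb (Σ A : N, Fin (κ A)) T, mapNt Sigma.fst s' = s ∧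
        CapOK (fun _ => 1) (x ++ [s'] ++ y) by
      obtain ⟨s', rfl, hs'⟩ := hs
      obtain ⟨r', rfl, hr'⟩ := ih (x ++ [s']) hs' (by simpa using h)
      exact ⟨s' :: r', rfl, by simpa using hr'⟩
    obtain A | t := s
    · obtain ⟨i, hi⟩ : ∃ i : Fin (κ A), symCount ⟨A, i⟩ (x ++ y) = 0 := by
        by_contra! hne
        have hle := Finset.card_nsmul_le_sum Finset.univ
          (fun i : Fin (κ A) => symCount ⟨A, i⟩ (x ++ y)) 1
          (fun i _ => Nat.one_le_iff_ne_zero.2 (hne i))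
        have hA := h A
        rw [← symCount_map_mapNt_fst] at hle
        simp [symCount_append, symCount] at hle hA
        omega
      refine ⟨Symb.nt ⟨A, i⟩, rfl, fun B => ?_⟩
      have hB := hxy B
      by_cases hBi : (⟨A, i⟩ : Σ A : N, Fin (κ A)) = B
      · subst hBi
        simp [symCount_append, symCount] at hi ⊢
        omega
      · simpa [symCount_append, symCount, hBi] using hB
    · exact ⟨Symb.tm t, rfl, fun B => by
        simpa [symCount_append, symCount] using hxy B⟩

theorem GSG.CapStep.exists_lift [Fintype N] {G : GSG N T} {κ : N → ℕ}
    {S : Σ A : N, Fin (κ A)} {u' : List (Symb (Σ A : N, Fin (κ A)) T)} {v : List (Symb N T)}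
    (hu' : CapOK (fun _ => 1) u') (h : G.CapStep κ (u'.map (mapNt Sigma.fst)) v) :
    ∃ v', v'.map (mapNt Sigma.fst) = v ∧
      (G.comap Sigma.fst S).CapStep (fun _ => 1) u' v' := by
  obtain ⟨⟨⟨⟨A, l⟩, w⟩, hr, x, y, hu, rfl⟩, -, hv⟩ := h
  obtain ⟨x₁, y', rfl, hx₁, rfl⟩ := List.map_eq_append_iff.1 hu
  obtain ⟨x', l₁, rfl, rfl, hl₁⟩ := List.map_eq_append_iff.1 hx₁
  obtain ⟨_ | ⟨A', l'⟩, rfl, hl'⟩ := exists_map_nt_of_map_mapNt _ _ _ hl₁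
  · simp at hl'
  obtain ⟨rfl, rfl⟩ : A'.1 = A ∧ l'.map Sigma.fst = l := by simpa using hl'
  have hxy : CapOK (fun _ => 1) (x' ++ y') := fun B => by
    have hB := hu' B
    simp only [symCount_append] at hB ⊢
    omega
  obtain ⟨w', rfl, hw'⟩ := exists_capOK_one_lift w x' y' hxy hv
  exact ⟨x' ++ w' ++ y', by simp, ⟨((A', l'), w'),
    (G.mem_rules_comap _ S _).2 hr, x', y', rfl, rfl⟩, hu', hw'⟩

theorem GSG.capLang_comap [Fintype N] (G : GSG N T) (κ : N → ℕ) (i : Fin (κ G.start)) :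
    (G.comap Sigma.fst (⟨G.start, i⟩ : Σ A : N, Fin (κ A))).CapLang (fun _ => 1) =
      G.CapLang κ := by
  ext w
  constructor
  · intro h
    have := Relation.ReflTransGen.lift (r := (G.comap Sigma.fst ⟨G.start, i⟩).CapStep _) (p := G.CapStep κ) (List.map (mapNt Sigma.fst))
      (fun u v huv => ⟨huv.1.of_comap, huv.2.1.map_mapNt_fst, huv.2.2.map_mapNt_fst⟩) _ _ h
    rwa [Function.onFun, map_mapNt_map_tm] at this
  · intro h
    suffices hlift : ∀ v, Relation.ReflTransGen (G.CapStep κ) [Symb.nt G.start] v →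
        ∃ v', v'.map (mapNt Sigma.fst) = v ∧ CapOK (fun _ => 1) v' ∧
          Relation.ReflTransGen ((G.comap Sigma.fst ⟨G.start, i⟩).CapStep (fun _ => 1))
            [Symb.nt (⟨G.start, i⟩ : Σ A : N, Fin (κ A))] v' by
      obtain ⟨v', hv', -, hder⟩ := hlift _ h
      rwa [eq_map_tm_of_map_mapNt _ _ _ hv'] at hder
    intro v hv
    induction hv with
    | refl =>
      refine ⟨_, rfl, fun B => ?_, .refl⟩
      simp only [symCount, add_zero]
      split_ifs <;> simp
    | tail _ hstep ih =>
      obtain ⟨u', rfl, hu', hder⟩ := ih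
      obtain ⟨v', rfl, hv'⟩ := hstep.exists_lift (S := ⟨G.start, i⟩) hu'
      exact ⟨v', rfl, hv'.2.2, hder.tail hv'⟩

theorem not_reflTransGen_map_tm {R : List (Symb N T) → List (Symb N T) → Prop} {A : N}
    (hR : ∀ v, ¬ R [Symb.nt A] v) (w : List T) :
    ¬ Relation.ReflTransGen R [Symb.nt A] (w.map Symb.tm) := by
  intro h
  obtain h | ⟨v, hv, -⟩ := Relation.ReflTransGen.cases_head h
  · cases w <;> simp at h
  · exact hR v hv

/-- every capacity-bounded Ginsburg–Spanier phrase structure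
grammar has an equivalent one with capacity function constantly 1. -/
theorem capacity_one_normal_form_gs {T : Type} (N : Type) [Fintype N]
    (G : GSG N T) (κ : N → ℕ) :
    ∃ (N' : Type) (_ : Fintype N') (G' : GSG N' T),
      GSG.CapLang G' (fun _ => 1) = G.CapLang κ := by
  obtain h0 | hpos := Nat.eq_zero_or_pos (κ G.start)
  · refine ⟨Unit, inferInstance, ⟨(), ∅⟩, ?_⟩
    ext w
    refine iff_of_false (not_reflTransGen_map_tm ?_ w) (not_reflTransGen_map_tm ?_ w)
    · rintro v ⟨⟨r, hr, -⟩, -⟩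
      simp at hr
    · rintro v ⟨-, hcap, -⟩
      have hS := hcap G.start
      simp [symCount, h0] at hS
  · exact ⟨Σ A : N, Fin (κ A), inferInstance, G.comap Sigma.fst ⟨G.start, ⟨0, hpos⟩⟩,
      G.capLang_comap κ ⟨0, hpos⟩⟩

end CapGram
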